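/- As s → +∞, e^{2πs}·V(s)/s converges to 2/π; that is, V(s) has the asymptotic behaviour V(s) ∼ (2/π)·s·e^{−2πs} at infinity. -/

import Mathlib

open Real Filter

/-- The wall-interaction energy `V(s) = (1/π)·s·coth(πs) − (1/π²)·log(2·sinh(πs))`. -/
noncomputable def V (s : ℝ) : ℝ :=
  (1 / Real.pi) * s * (Real.cosh (Real.pi * s) / Real.sinh (Real.pi * s))
    - (1 / Real.pi ^ 2) * Real.log (2 * Real.sinh (Real.pi * s))

theorem log_two_mul_sinh {x : ℝ} (hx : 0 < x) :
    Real.log (2 * Real.sinh x) = x + Real.log (1 - Real.exp (-(2 * x))) := by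
  have hq : Real.exp (-(2 * x)) < 1 := Real.exp_lt_one_iff.2 (by linarith)
  have h : 2 * Real.sinh x = Real.exp x * (1 - Real.exp (-(2 * x))) := by
    rw [mul_sub, ← Real.exp_add, Real.sinh_eq]
    ring_nf
  rw [h, Real.log_mul (Real.exp_pos x).ne' (by linarith), Real.log_exp]

theorem cosh_div_sinh {x : ℝ} (hx : 0 < x) :
    Real.cosh x / Real.sinh x =
      (1 + Real.exp (-(2 * x))) / (1 - Real.exp (-(2 * x))) := by
  have hq : Real.exp (-(2 * x)) < 1 := Real.exp_lt_one_iff.2 (by linarith)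
  have hs : Real.sinh x ≠ 0 := (Real.sinh_pos_iff.2 hx).ne'
  have h : Real.exp (-(2 * x)) = Real.exp (-x) * Real.exp (-x) := by
    rw [← Real.exp_add]; ring_nf
  have h1 : Real.exp x * Real.exp (-x) = 1 := by rw [← Real.exp_add]; simp
  rw [div_eq_div_iff hs (by linarith), h, Real.cosh_eq, Real.sinh_eq]
  linear_combination (-Real.exp (-x)) * h1

theorem exp_mul_V_div {s : ℝ} (hs : 0 < s) :
    Real.exp (2 * Real.pi * s) * V s / s =
      2 / Real.pi * (1 - Real.exp (-(2 * (Real.pi * s))))⁻¹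
        - 1 / Real.pi ^ 2 *
          (Real.log (1 - Real.exp (-(2 * (Real.pi * s)))) / Real.exp (-(2 * (Real.pi * s))))
            * s⁻¹ := by
  have hx : 0 < Real.pi * s := mul_pos Real.pi_pos hs
  have hq : 1 - Real.exp (-(2 * (Real.pi * s))) ≠ 0 :=
    (sub_pos.2 (Real.exp_lt_one_iff.2 (by linarith))).ne'
  have he : Real.exp (2 * Real.pi * s) = (Real.exp (-(2 * (Real.pi * s))))⁻¹ := by
    rw [← Real.exp_neg]; ring_nf
  rw [V, log_two_mul_sinh hx, cosh_div_sinh hx, he]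
  have hq0 := (Real.exp_pos (-(2 * (Real.pi * s)))).ne'
  generalize Real.exp (-(2 * (Real.pi * s))) = q at *
  field_simp
  ring

theorem tendsto_log_one_sub_div :
    Tendsto (fun q : ℝ => Real.log (1 - q) / q) (nhdsWithin 0 {0}ᶜ) (nhds (-1)) := by
  have h : HasDerivAt (fun q : ℝ => Real.log (1 - q)) (-1) 0 := by
    simpa using ((hasDerivAt_id (0 : ℝ)).const_sub 1).log (by simp)
  simpa [slope_fun_def_field] using h.tendsto_slope

/-- As `s → +∞`, `e^{2πs}·V(s)/s → 2/π`, i.e. `V(s) ∼ (2/π)·s·e^{−2πs}` at infinity. -/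
theorem stmt4 :
    Tendsto (fun s : ℝ => Real.exp (2 * Real.pi * s) * V s / s) atTop
      (nhds (2 / Real.pi)) := by
  have hq : Tendsto (fun s : ℝ => Real.exp (-(2 * (Real.pi * s)))) atTop (nhds 0) :=
    Real.tendsto_exp_neg_atTop_nhds_zero.comp
      ((tendsto_id.const_mul_atTop Real.pi_pos).const_mul_atTop two_pos)
  have hq' : Tendsto (fun s : ℝ => Real.exp (-(2 * (Real.pi * s)))) atTop
      (nhdsWithin 0 {0}ᶜ) :=
    tendsto_nhdsWithin_iff.2 ⟨hq, Eventually.of_forall fun s => (Real.exp_pos _).ne'⟩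
  have hcoth := ((hq.const_sub 1).inv₀ (by norm_num)).const_mul (2 / Real.pi)
  have hlog := ((tendsto_log_one_sub_div.comp hq').const_mul (1 / Real.pi ^ 2)).mul
    tendsto_inv_atTop_zero
  have h := hcoth.sub hlog
  simp only [sub_zero, inv_one, mul_one, mul_zero] at h
  refine h.congr' ?_
  filter_upwards [eventually_gt_atTop 0] with s hs
  exact (exp_mul_V_div hs).symm
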